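/- (Proposition A, j = 2.) Let η > 0, τ > 0, B = {y ∈ ℝ³ : |y| < η}, and x ∈ B with x ≠ 0. Then ∫_B ( e^{−τ|x−y|} / |x−y| ) · |y|² dy = (4π/τ²)·( |x|² + 6/τ² − e^{−τη}·(η³ + 3η²/τ + 6η/τ² + 6/τ³)·sinh(τ|x|)/|x| ). -/

import Mathlib

open MeasureTheory Real

lemma aux_ftc (f f' : ℝ → ℝ) (a b : ℝ) (hab : a ≤ b) (hc : ContinuousOn f (Set.Icc a b))
    (hd : ∀ x ∈ Set.Ioo a b, HasDerivAt f (f' x) x) (hn : ∀ x ∈ Set.Ioo a b, 0 ≤ f' x)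
    (V : ℝ) (hV : f b - f a = V) :
    ∫⁻ x in Set.Ioo a b, ENNReal.ofReal (f' x) = ENNReal.ofReal V ∧ 0 ≤ V := by
  subst hV
  have hint : IntegrableOn f' (Set.Ioc a b) :=
    intervalIntegral.integrableOn_deriv_of_nonneg hc hd hn
  rw [← intervalIntegral.integral_eq_sub_of_hasDerivAt_of_le hab hc hd
    ((intervalIntegrable_iff_integrableOn_Ioc_of_le hab).2 hint),
    intervalIntegral.integral_of_le hab, integral_Ioc_eq_integral_Ioo]
  refine ⟨?_, setIntegral_nonneg measurableSet_Ioo hn⟩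
  rw [ofReal_integral_eq_lintegral_ofReal]
  · exact hint.mono_set Set.Ioo_subset_Ioc_self
  · filter_upwards [ae_restrict_mem measurableSet_Ioo] with x hx using hn x hx

lemma aux_plane (H : ℝ → ENNReal) (hH : Measurable H) (z : ℝ) :
    ∫⁻ w : ℝ × ℝ, H (z ^ 2 + (w.1 ^ 2 + w.2 ^ 2))
      = ENNReal.ofReal π * ∫⁻ p in Set.Ioi (z ^ 2), H p := by
  have himg : (fun r : ℝ => z ^ 2 + r ^ 2) '' Set.Ioi 0 = Set.Ioi (z ^ 2) := by
    ext p
    simp only [Set.mem_image, Set.mem_Ioi]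
    constructor
    · rintro ⟨r, hr, rfl⟩
      have : 0 < r ^ 2 := by positivity
      linarith
    · intro hp
      refine ⟨√(p - z ^ 2), Real.sqrt_pos.2 (by linarith), ?_⟩
      rw [Real.sq_sqrt (by linarith)]; ring
  have hinj : Set.InjOn (fun r : ℝ => z ^ 2 + r ^ 2) (Set.Ioi 0) := by
    intro r hr s hs h
    simp only [add_right_inj] at h
    exact (pow_left_inj₀ (le_of_lt hr) (le_of_lt hs) two_ne_zero).1 h
  rw [← himg, lintegral_image_eq_lintegral_abs_deriv_mul measurableSet_Ioi
    (f' := fun r => 2 * r)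
    (fun r _ => by
      have := ((hasDerivAt_pow 2 r).const_add (z ^ 2)).hasDerivWithinAt (s := Set.Ioi 0)
      simpa using this) hinj]
  rw [← lintegral_comp_polarCoord_symm (fun w => H (z ^ 2 + (w.1 ^ 2 + w.2 ^ 2)))]
  have e : ∀ p : ℝ × ℝ, ENNReal.ofReal p.1 • H (z ^ 2 + ((polarCoord.symm p).1 ^ 2 +
      (polarCoord.symm p).2 ^ 2)) = ENNReal.ofReal p.1 * H (z ^ 2 + p.1 ^ 2) := by
    intro p
    simp only [polarCoord_symm_apply, smul_eq_mul]
    congr 3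
    linear_combination p.1 ^ 2 * (Real.sin_sq_add_cos_sq p.2)
  simp_rw [e]
  have tgt : polarCoord.target = Set.Ioi (0 : ℝ) ×ˢ Set.Ioo (-π) π := rfl
  rw [tgt, Measure.volume_eq_prod, ← Measure.prod_restrict]
  rw [lintegral_prod_symm' _ (by fun_prop)]
  simp only
  rw [lintegral_const, Measure.restrict_apply_univ,
    Real.volume_Ioo, show π - -π = π * 2 by ring, ENNReal.ofReal_mul Real.pi_pos.le, mul_comm,
    mul_assoc, ← lintegral_const_mul _ (by fun_prop)]
  congr 1
  refine setLIntegral_congr_fun measurableSet_Ioi fun r hr => ?_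
  have hr' : (0 : ℝ) < r := hr
  rw [abs_of_pos (by positivity), ENNReal.ofReal_mul zero_le_two, mul_assoc]

lemma aux_space (G : ℝ × ℝ → ENNReal) (hG : Measurable G) :
    ∫⁻ y : EuclideanSpace ℝ (Fin 3), G (y 0, ‖y‖ ^ 2)
      = ENNReal.ofReal π *
        ∫⁻ p in Set.Ioi (0 : ℝ), ∫⁻ z in Set.Ioo (-√p) (√p), G (z, p) := by
  have h1 : ∫⁻ y : EuclideanSpace ℝ (Fin 3), G (y 0, ‖y‖ ^ 2)
      = ∫⁻ y : Fin 3 → ℝ, G (y 0, y 0 ^ 2 + (y 1 ^ 2 + y 2 ^ 2)) := by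
    rw [← (PiLp.volume_preserving_ofLp (Fin 3)).lintegral_comp_emb
      (MeasurableEquiv.toLp 2 (Fin 3 → ℝ)).symm.measurableEmbedding]
    refine lintegral_congr fun y => ?_
    rw [EuclideanSpace.norm_sq_eq, Fin.sum_univ_three]
    simp [add_assoc]
  have h2 : ∫⁻ y : Fin 3 → ℝ, G (y 0, y 0 ^ 2 + (y 1 ^ 2 + y 2 ^ 2))
      = ∫⁻ q : ℝ × (Fin 2 → ℝ), G (q.1, q.1 ^ 2 + (q.2 0 ^ 2 + q.2 1 ^ 2)) := by
    rw [← (volume_preserving_piFinSuccAbove (fun _ : Fin 3 => ℝ) 0).lintegral_comp_emb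
      (MeasurableEquiv.measurableEmbedding _)]
    rfl
  have h3 : ∀ z : ℝ, ∫⁻ q : Fin 2 → ℝ, G (z, z ^ 2 + (q 0 ^ 2 + q 1 ^ 2))
      = ENNReal.ofReal π * ∫⁻ p in Set.Ioi (z ^ 2), G (z, p) := by
    intro z
    rw [← aux_plane (fun p => G (z, p)) (by fun_prop), ← (volume_preserving_finTwoArrow ℝ).lintegral_comp_emb
      (MeasurableEquiv.measurableEmbedding _)]
    rfl
  rw [h1, h2, Measure.volume_eq_prod, lintegral_prod _ (by fun_prop)]
  simp_rw [h3]
  have hS : MeasurableSet {q : ℝ × ℝ | q.1 ^ 2 < q.2} :=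
    measurableSet_lt (by fun_prop) (by fun_prop)
  have hI : Measurable ({q : ℝ × ℝ | q.1 ^ 2 < q.2}.indicator G) := hG.indicator hS
  rw [lintegral_const_mul' _ _ ENNReal.ofReal_ne_top]
  congr 1
  calc ∫⁻ z : ℝ, ∫⁻ p in Set.Ioi (z ^ 2), G (z, p)
      = ∫⁻ z : ℝ, ∫⁻ p : ℝ, {q : ℝ × ℝ | q.1 ^ 2 < q.2}.indicator G (z, p) := by
        refine lintegral_congr fun z => ?_
        rw [← lintegral_indicator measurableSet_Ioi]
        rfl
    _ = ∫⁻ p : ℝ, ∫⁻ z : ℝ, {q : ℝ × ℝ | q.1 ^ 2 < q.2}.indicator G (z, p) :=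
        lintegral_lintegral_swap hI.aemeasurable
    _ = _ := by
        rw [← lintegral_indicator measurableSet_Ioi]
        refine lintegral_congr fun p => ?_
        by_cases hp : 0 < p
        · rw [Set.indicator_of_mem (show p ∈ Set.Ioi 0 from hp),
            ← lintegral_indicator measurableSet_Ioo]
          refine lintegral_congr fun z => ?_
          simp only [Set.indicator, Set.mem_ofPred_eq, Set.mem_Ioo, Real.sq_lt]
        · rw [Set.indicator_of_notMem (by simpa using hp)]
          refine (lintegral_congr fun z => ?_).trans lintegral_zero
          refine Set.indicator_of_notMem ?_ _
          simp only [Set.mem_ofPred_eq, not_lt]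
          nlinarith [sq_nonneg z]

lemma aux_inner (τ a p : ℝ) (hτ : 0 < τ) (ha : 0 < a) (hp : 0 < p) :
    ∫⁻ z in Set.Ioo (-√p) (√p), ENNReal.ofReal
        (Real.exp (-τ * √(p - 2 * a * z + a ^ 2)) / √(p - 2 * a * z + a ^ 2))
      = ENNReal.ofReal (1 / (τ * a) *
          (Real.exp (-τ * |√p - a|) - Real.exp (-τ * (√p + a)))) := by
  have hs : √p ^ 2 = p := Real.sq_sqrt hp.le
  have hs0 : 0 < √p := Real.sqrt_pos.2 hp
  have hpos : ∀ z ∈ Set.Ioo (-√p) (√p), 0 < p - 2 * a * z + a ^ 2 := by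
    intro z hz
    nlinarith [sq_nonneg (√p - a), mul_pos ha (sub_pos.2 hz.2)]
  refine (aux_ftc (fun z => 1 / (τ * a) * Real.exp (-τ * √(p - 2 * a * z + a ^ 2))) _ _ _
    (by linarith) (by fun_prop) ?_ ?_ _ ?_).1
  rotate_left 2
  · have e1 : p - 2 * a * √p + a ^ 2 = (√p - a) ^ 2 := by nlinarith
    have e2 : p - 2 * a * (-√p) + a ^ 2 = (√p + a) ^ 2 := by nlinarith
    simp only [e1, e2]
    rw [Real.sqrt_sq_eq_abs, Real.sqrt_sq (by positivity)]
    ring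
  · intro z hz
    have h := hpos z hz
    have h' := Real.sqrt_pos.2 h
    have d1 : HasDerivAt (fun z : ℝ => p - 2 * a * z + a ^ 2) (-(2 * a)) z := by
      have := (((hasDerivAt_id z).const_mul (2 * a)).const_sub p).add_const (a ^ 2)
      simpa using this
    have d2 := (((d1.sqrt h.ne').const_mul (-τ)).exp).const_mul (1 / (τ * a))
    convert! d2 using 1
    field_simp
  · intro z hz
    positivity

lemma aux_outer1 (τ a : ℝ) (hτ : 0 < τ) (ha : 0 < a) :
    ∫⁻ p in Set.Ioo 0 (a ^ 2), ENNReal.ofReal (p * (1 / (τ * a) *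
          (Real.exp (-τ * |√p - a|) - Real.exp (-τ * (√p + a)))))
      = ENNReal.ofReal (4 / (τ * a) * Real.exp (-τ * a) * (a ^ 3 * Real.cosh (τ * a) / τ
          - 3 * a ^ 2 * Real.sinh (τ * a) / τ ^ 2 + 6 * a * Real.cosh (τ * a) / τ ^ 3
          - 6 * Real.sinh (τ * a) / τ ^ 4)) ∧
      0 ≤ 4 / (τ * a) * Real.exp (-τ * a) * (a ^ 3 * Real.cosh (τ * a) / τ
          - 3 * a ^ 2 * Real.sinh (τ * a) / τ ^ 2 + 6 * a * Real.cosh (τ * a) / τ ^ 3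
          - 6 * Real.sinh (τ * a) / τ ^ 4) := by
  refine aux_ftc (fun p => 4 / (τ * a) * Real.exp (-τ * a) *
      (√p ^ 3 * Real.cosh (τ * √p) / τ
          - 3 * √p ^ 2 * Real.sinh (τ * √p) / τ ^ 2 + 6 * √p * Real.cosh (τ * √p) / τ ^ 3
          - 6 * Real.sinh (τ * √p) / τ ^ 4)) _ _ _ (by positivity) (by fun_prop)
      ?_ ?_ _ ?_
  rotate_left 2
  · simp [Real.sqrt_sq ha.le]
  · intro p hp
    have hp0 : 0 < p := hp.1
    have hs : √p ^ 2 = p := Real.sq_sqrt hp0.le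
    have hs0 : 0 < √p := Real.sqrt_pos.2 hp0
    have hsa : √p < a := (Real.sqrt_lt' ha).2 hp.2
    have hP : ∀ r : ℝ, HasDerivAt (fun r : ℝ => 4 / (τ * a) * Real.exp (-τ * a) *
      (r ^ 3 * Real.cosh (τ * r) / τ
          - 3 * r ^ 2 * Real.sinh (τ * r) / τ ^ 2 + 6 * r * Real.cosh (τ * r) / τ ^ 3
          - 6 * Real.sinh (τ * r) / τ ^ 4))
        (4 / (τ * a) * Real.exp (-τ * a) * (r ^ 3 * Real.sinh (τ * r))) r := by
      intro r
      have l : HasDerivAt (fun r : ℝ => τ * r) τ r := by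
        simpa using (hasDerivAt_id r).const_mul τ
      have c := l.cosh
      have s := l.sinh
      have q := (((((hasDerivAt_pow 3 r).mul c).div_const τ).sub
        ((((hasDerivAt_pow 2 r).const_mul 3).mul s).div_const (τ ^ 2))).add
        ((((hasDerivAt_id r).const_mul 6).mul c).div_const (τ ^ 3))).sub
        ((s.const_mul 6).div_const (τ ^ 4))
      have q' := q.const_mul (4 / (τ * a) * Real.exp (-τ * a))
      convert! q' using 1
      simp only [id]
      field_simp
      push_cast
      ring
    have := (hP (√p)).comp p (Real.hasDerivAt_sqrt hp0.ne')
    convert! this using 1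
    rw [abs_of_neg (by linarith), Real.sinh_eq,
      show -τ * -(√p - a) = -τ * a + τ * √p by ring,
      show -τ * (√p + a) = -τ * a + -(τ * √p) by ring, Real.exp_add, Real.exp_add]
    nth_rewrite 1 [← hs]
    field_simp
    ring
  · intro p hp
    have hp0 : 0 < p := hp.1
    have hs0 : 0 < √p := Real.sqrt_pos.2 hp0
    have : Real.exp (-τ * (√p + a)) ≤ Real.exp (-τ * |√p - a|) := by
      apply Real.exp_le_exp.2
      have : |√p - a| ≤ √p + a := abs_le.2 ⟨by linarith, by linarith⟩
      nlinarith
    have := sub_nonneg.2 this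
    positivity

lemma aux_outer2 (τ a η : ℝ) (hτ : 0 < τ) (ha : 0 < a) (hη : a < η) :
    ∫⁻ p in Set.Ioo (a ^ 2) (η ^ 2), ENNReal.ofReal (p * (1 / (τ * a) *
          (Real.exp (-τ * |√p - a|) - Real.exp (-τ * (√p + a)))))
      = ENNReal.ofReal (4 / (τ * a) * Real.sinh (τ * a) *
          (Real.exp (-τ * a) * (a ^ 3 / τ + 3 * a ^ 2 / τ ^ 2 + 6 * a / τ ^ 3 + 6 / τ ^ 4)
          - Real.exp (-τ * η) *
            (η ^ 3 / τ + 3 * η ^ 2 / τ ^ 2 + 6 * η / τ ^ 3 + 6 / τ ^ 4))) ∧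
      0 ≤ 4 / (τ * a) * Real.sinh (τ * a) *
          (Real.exp (-τ * a) * (a ^ 3 / τ + 3 * a ^ 2 / τ ^ 2 + 6 * a / τ ^ 3 + 6 / τ ^ 4)
          - Real.exp (-τ * η) *
            (η ^ 3 / τ + 3 * η ^ 2 / τ ^ 2 + 6 * η / τ ^ 3 + 6 / τ ^ 4)) := by
  have hη0 : 0 < η := ha.trans hη
  refine aux_ftc (fun p => -(4 / (τ * a) * Real.sinh (τ * a)) * (Real.exp (-τ * √p) *
      (√p ^ 3 / τ + 3 * √p ^ 2 / τ ^ 2 + 6 * √p / τ ^ 3 + 6 / τ ^ 4))) _ _ _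
      (by gcongr) (by fun_prop) ?_ ?_ _ ?_
  rotate_left 2
  · simp only [Real.sqrt_sq ha.le, Real.sqrt_sq hη0.le]
    ring
  · intro p hp
    have hp0 : 0 < p := lt_trans (by positivity) hp.1
    have hs : √p ^ 2 = p := Real.sq_sqrt hp0.le
    have hs0 : 0 < √p := Real.sqrt_pos.2 hp0
    have hsa : a < √p := (Real.lt_sqrt ha.le).2 hp.1
    have hP : ∀ r : ℝ, HasDerivAt (fun r : ℝ => -(4 / (τ * a) * Real.sinh (τ * a)) *
      (Real.exp (-τ * r) * (r ^ 3 / τ + 3 * r ^ 2 / τ ^ 2 + 6 * r / τ ^ 3 + 6 / τ ^ 4)))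
        (4 / (τ * a) * Real.sinh (τ * a) * (r ^ 3 * Real.exp (-τ * r))) r := by
      intro r
      have l : HasDerivAt (fun r : ℝ => -τ * r) (-τ) r := by
        simpa using (hasDerivAt_id r).const_mul (-τ)
      have q := (((((hasDerivAt_pow 3 r).div_const τ).add
        (((hasDerivAt_pow 2 r).const_mul 3).div_const (τ ^ 2))).add
        (((hasDerivAt_id r).const_mul 6).div_const (τ ^ 3))).add_const (6 / τ ^ 4))
      have q' := (l.exp.mul q).const_mul (-(4 / (τ * a) * Real.sinh (τ * a)))
      convert! q' using 1
      simp only [id, Pi.add_apply]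
      field_simp
      push_cast
      ring
    have := (hP (√p)).comp p (Real.hasDerivAt_sqrt hp0.ne')
    convert! this using 1
    rw [abs_of_pos (by linarith), Real.sinh_eq,
      show -τ * (√p - a) = -τ * √p + τ * a by ring,
      show -τ * (√p + a) = -τ * √p + -(τ * a) by ring, Real.exp_add, Real.exp_add]
    nth_rewrite 1 [← hs]
    field_simp
    ring
  · intro p hp
    have hp0 : 0 < p := lt_trans (by positivity) hp.1
    have hs0 : 0 < √p := Real.sqrt_pos.2 hp0
    have : Real.exp (-τ * (√p + a)) ≤ Real.exp (-τ * |√p - a|) := by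
      apply Real.exp_le_exp.2
      have : |√p - a| ≤ √p + a := abs_le.2 ⟨by linarith, by linarith⟩
      nlinarith
    have := sub_nonneg.2 this
    positivity

/-- Proposition A, `j = 2`. -/
theorem stmt_11 (η τ : ℝ) (hη : 0 < η) (hτ : 0 < τ)
    (x : EuclideanSpace ℝ (Fin 3)) (hx : ‖x‖ < η) (hx0 : x ≠ 0) :
    ∫ y in Metric.ball (0 : EuclideanSpace ℝ (Fin 3)) η,
        Real.exp (-τ * ‖x - y‖) / ‖x - y‖ * ‖y‖ ^ 2
      = (4 * π / τ ^ 2) *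
        (‖x‖ ^ 2 + 6 / τ ^ 2
          - Real.exp (-τ * η) *
              (η ^ 3 + 3 * η ^ 2 / τ + 6 * η / τ ^ 2 + 6 / τ ^ 3) *
              Real.sinh (τ * ‖x‖) / ‖x‖) := by
  have ha : 0 < ‖x‖ := norm_pos_iff.2 hx0
  obtain ⟨b, hb⟩ : ∃ b : OrthonormalBasis (Fin 3) ℝ (EuclideanSpace ℝ (Fin 3)),
      b 0 = ‖x‖⁻¹ • x := by
    obtain ⟨b, hb⟩ := Orthonormal.exists_orthonormalBasis_extension_of_card_eq
      (𝕜 := ℝ) (E := EuclideanSpace ℝ (Fin 3)) (ι := Fin 3) (by simp)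
      (v := fun _ => ‖x‖⁻¹ • x) (s := {0}) (by
        refine ⟨fun i => ?_, fun i j hij => (hij (Subsingleton.elim _ _)).elim⟩
        simp [norm_smul, ha.ne'])
    exact ⟨b, hb 0 rfl⟩
  set a := ‖x‖ with hadef
  have hz : ∀ y, inner ℝ x y = a * b.repr y 0 := by
    intro y
    rw [b.repr_apply_apply, hb, inner_smul_left]
    simp
    field_simp
  have hxy : ∀ y, ‖x - y‖ = √(‖b.repr y‖ ^ 2 - 2 * a * (b.repr y 0) + a ^ 2) := by
    intro y
    rw [← Real.sqrt_sq (norm_nonneg (x - y)), norm_sub_sq_real, hz,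
      LinearIsometryEquiv.norm_map]
    congr 1
    ring
  rw [integral_eq_lintegral_of_nonneg_ae
    (Filter.Eventually.of_forall fun y => by positivity)
    (Measurable.aestronglyMeasurable (by fun_prop)),
    ← lintegral_indicator Metric.isOpen_ball.measurableSet]
  let G : ℝ × ℝ → ENNReal := {q : ℝ × ℝ | q.2 < η ^ 2}.indicator fun q =>
    ENNReal.ofReal (Real.exp (-τ * √(q.2 - 2 * a * q.1 + a ^ 2)) /
      √(q.2 - 2 * a * q.1 + a ^ 2) * q.2)
  have hG : Measurable G :=
    Measurable.indicator (by fun_prop) (measurableSet_lt (by fun_prop) (by fun_prop))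
  have h1 : ∫⁻ y, (Metric.ball (0 : EuclideanSpace ℝ (Fin 3)) η).indicator (fun y =>
      ENNReal.ofReal (Real.exp (-τ * ‖x - y‖) / ‖x - y‖ * ‖y‖ ^ 2)) y
      = ∫⁻ y : EuclideanSpace ℝ (Fin 3), G (y 0, ‖y‖ ^ 2) := by
    rw [← b.measurePreserving_repr.lintegral_comp_emb
      b.repr.toHomeomorph.measurableEmbedding (fun y => G (y 0, ‖y‖ ^ 2))]
    refine lintegral_congr fun y => ?_
    have hiff : ‖y‖ < η ↔ ‖y‖ ^ 2 < η ^ 2 :=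
      (pow_lt_pow_iff_left₀ (norm_nonneg _) hη.le two_ne_zero).symm
    simp only [G, Set.indicator, mem_ball_zero_iff, Set.mem_ofPred_eq, hxy,
      LinearIsometryEquiv.norm_map, hiff]
  have h2 : ∀ p ∈ Set.Ioi (0 : ℝ), ∫⁻ z in Set.Ioo (-√p) (√p), G (z, p)
      = (Set.Iio (η ^ 2)).indicator (fun p => ENNReal.ofReal (p * (1 / (τ * a) *
          (Real.exp (-τ * |√p - a|) - Real.exp (-τ * (√p + a)))))) p := by
    intro p hp
    have hp' : (0 : ℝ) < p := hp
    by_cases h : p < η ^ 2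
    · rw [Set.indicator_of_mem (show p ∈ Set.Iio (η ^ 2) from h), ENNReal.ofReal_mul hp'.le,
        ← aux_inner τ a p hτ ha hp', ← lintegral_const_mul _ (by fun_prop)]
      refine lintegral_congr fun z => ?_
      rw [← ENNReal.ofReal_mul hp'.le]
      simp only [G, Set.indicator, Set.mem_ofPred_eq, h, if_true]
      rw [mul_comm]
    · rw [Set.indicator_of_notMem (by simpa using h)]
      simp [G, h]
  have h3 : Set.Iio (η ^ 2) ∩ Set.Ioi (0 : ℝ) = Set.Ioo 0 (a ^ 2) ∪ Set.Ico (a ^ 2) (η ^ 2) := by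
    rw [Set.Ioo_union_Ico_eq_Ioo (by positivity) (by gcongr), Set.inter_comm]
    rfl
  rw [h1, aux_space G hG, setLIntegral_congr_fun measurableSet_Ioi h2,
    lintegral_indicator measurableSet_Iio, Measure.restrict_restrict measurableSet_Iio, h3,
    lintegral_union measurableSet_Ico (by
      rw [Set.disjoint_left]; intro p hp hq; exact absurd hp.2 (not_lt.2 hq.1)),
    setLIntegral_congr (s := Set.Ico (a ^ 2) (η ^ 2)) Ioo_ae_eq_Ico.symm,
    (aux_outer1 τ a hτ ha).1, (aux_outer2 τ a η hτ ha hx).1,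
    ← ENNReal.ofReal_add (aux_outer1 τ a hτ ha).2 (aux_outer2 τ a η hτ ha hx).2,
    ← ENNReal.ofReal_mul Real.pi_pos.le, ENNReal.toReal_ofReal (mul_nonneg Real.pi_pos.le
      (add_nonneg (aux_outer1 τ a hτ ha).2 (aux_outer2 τ a η hτ ha hx).2))]
  have e1 : Real.exp (-τ * a) * (Real.cosh (τ * a) + Real.sinh (τ * a)) = 1 := by
    rw [Real.cosh_add_sinh, ← Real.exp_add]
    simp
  have ha' := ha.ne'
  have hτ' := hτ.ne'
  clear_value a
  have e2 : 4 * π / τ ^ 2 * (a ^ 2 + 6 / τ ^ 2) =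
      4 * π / τ ^ 2 * (a ^ 2 + 6 / τ ^ 2) *
        (Real.exp (-τ * a) * (Real.cosh (τ * a) + Real.sinh (τ * a))) := by
    rw [e1, mul_one]
  rw [mul_sub (4 * π / τ ^ 2), e2]
  field_simp
  ring
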